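/- (Weighted Hardy type inequality for Grushin operators with explicit constant.) Let p > 1 and α ∈ ℝ satisfy 1/p + α/Q > 0 and Q − p + αp > 0. Then for every u ∈ C_0^∞(ℝ^{d+k}): ∫_{ℝ^{d+k}} ρ^{αp} (|x|^{μp}/ρ^{μp}) · |u|^p / ρ^p dx dy ≤ (p/(Q − p + αp))^p ∫_{ℝ^{d+k}} ρ^{αp} |∇_μ u|^p dx dy. -/

import Mathlib

open MeasureTheory Real
open scoped RealInnerProductSpace ENNReal

/-- The anisotropic distance function `ρ(x,y) = (|x|^{2+2μ} + (1+μ)²|y|²)^{1/(2+2μ)}`. -/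
noncomputable def grho (μ : ℝ) {d k : ℕ}
    (z : EuclideanSpace ℝ (Fin d) × EuclideanSpace ℝ (Fin k)) : ℝ :=
  (‖z.1‖ ^ (2 + 2 * μ) + (1 + μ) ^ 2 * ‖z.2‖ ^ 2) ^ (1 / (2 + 2 * μ))

/-- The Grushin gradient `∇_μ u = (∇_x u, |x|^μ ∇_y u)`. -/
noncomputable def gradMu (μ : ℝ) {d k : ℕ}
    (u : EuclideanSpace ℝ (Fin d) × EuclideanSpace ℝ (Fin k) → ℝ)
    (z : EuclideanSpace ℝ (Fin d) × EuclideanSpace ℝ (Fin k)) :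
    EuclideanSpace ℝ (Fin d) × EuclideanSpace ℝ (Fin k) :=
  (gradient (fun x => u (x, z.2)) z.1, (‖z.1‖ ^ μ) • gradient (fun y => u (z.1, y)) z.2)

/-- The Euclidean-type norm `((|v₁|² + |v₂|²))^{1/2}` of a pair. -/
noncomputable def pairNorm {d k : ℕ}
    (v : EuclideanSpace ℝ (Fin d) × EuclideanSpace ℝ (Fin k)) : ℝ :=
  Real.sqrt (‖v.1‖ ^ 2 + ‖v.2‖ ^ 2)

/-- `|∇_μ u| = (|∇_x u|² + |x|^{2μ}|∇_y u|²)^{1/2}`. -/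
noncomputable def gradMuNorm (μ : ℝ) {d k : ℕ}
    (u : EuclideanSpace ℝ (Fin d) × EuclideanSpace ℝ (Fin k) → ℝ)
    (z : EuclideanSpace ℝ (Fin d) × EuclideanSpace ℝ (Fin k)) : ℝ :=
  pairNorm (gradMu μ u z)

open Set Filter Topology

variable {d k : ℕ}

/-- The one-parameter group of anisotropic dilations `(x, y) ↦ (eᵗ x, e^{(1+μ)t} y)`. -/
noncomputable def grushinDilation (μ t : ℝ)
    (z : EuclideanSpace ℝ (Fin d) × EuclideanSpace ℝ (Fin k)) :
    EuclideanSpace ℝ (Fin d) × EuclideanSpace ℝ (Fin k) :=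
  (exp t • z.1, exp ((1 + μ) * t) • z.2)

/-- The derivative of `u` along the generator `(x, (1 + μ) y)` of the anisotropic dilations. -/
noncomputable def grushinEuler (μ : ℝ)
    (u : EuclideanSpace ℝ (Fin d) × EuclideanSpace ℝ (Fin k) → ℝ)
    (z : EuclideanSpace ℝ (Fin d) × EuclideanSpace ℝ (Fin k)) : ℝ :=
  fderiv ℝ u z (z.1, (1 + μ) • z.2)

lemma grho_nonneg (μ : ℝ) (z : EuclideanSpace ℝ (Fin d) × EuclideanSpace ℝ (Fin k)) :
    0 ≤ grho μ z := by
  unfold grho; positivity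

lemma continuous_grho {μ : ℝ} (hμ : 0 < μ) :
    Continuous (grho μ : EuclideanSpace ℝ (Fin d) × EuclideanSpace ℝ (Fin k) → ℝ) := by
  unfold grho
  refine Continuous.rpow_const ?_ fun _ => Or.inr (by positivity)
  exact (continuous_fst.norm.rpow_const fun _ => Or.inr (by positivity)).add (by fun_prop)

lemma grho_rpow {μ : ℝ} (hμ : 0 < μ)
    (z : EuclideanSpace ℝ (Fin d) × EuclideanSpace ℝ (Fin k)) :
    grho μ z ^ (2 + 2 * μ) = ‖z.1‖ ^ (2 + 2 * μ) + (1 + μ) ^ 2 * ‖z.2‖ ^ 2 := by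
  rw [grho, ← rpow_mul (by positivity), one_div_mul_cancel (by positivity), rpow_one]

lemma grho_rpow_one_add {μ : ℝ} (hμ : 0 < μ)
    (z : EuclideanSpace ℝ (Fin d) × EuclideanSpace ℝ (Fin k)) :
    grho μ z ^ (1 + μ) = √(‖z.1‖ ^ (2 + 2 * μ) + (1 + μ) ^ 2 * ‖z.2‖ ^ 2) := by
  rw [← grho_rpow hμ, sqrt_eq_rpow, ← rpow_mul (grho_nonneg μ z)]
  ring_nf

lemma norm_fst_le_grho {μ : ℝ} (hμ : 0 < μ)
    (z : EuclideanSpace ℝ (Fin d) × EuclideanSpace ℝ (Fin k)) : ‖z.1‖ ≤ grho μ z := by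
  refine (rpow_le_rpow_iff (norm_nonneg _) (grho_nonneg μ z)
    (by positivity : 0 < 2 + 2 * μ)).1 ?_
  rw [grho_rpow hμ]
  exact le_add_of_nonneg_right (by positivity)

lemma norm_snd_le_grho_rpow {μ : ℝ} (hμ : 0 < μ)
    (z : EuclideanSpace ℝ (Fin d) × EuclideanSpace ℝ (Fin k)) :
    ‖z.2‖ ≤ grho μ z ^ (1 + μ) := by
  rw [grho_rpow_one_add hμ]
  refine le_sqrt_of_sq_le ?_
  have h1 : 0 ≤ ‖z.1‖ ^ (2 + 2 * μ) := by positivity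
  nlinarith [mul_nonneg hμ.le (sq_nonneg ‖z.2‖), mul_nonneg (sq_nonneg μ) (sq_nonneg ‖z.2‖)]

lemma grho_grushinDilation {μ : ℝ} (hμ : 0 < μ) (t : ℝ)
    (z : EuclideanSpace ℝ (Fin d) × EuclideanSpace ℝ (Fin k)) :
    grho μ (grushinDilation μ t z) = exp t * grho μ z := by
  have h1 : exp t ^ (2 + 2 * μ) = exp ((1 + μ) * t) ^ 2 := by
    rw [← exp_mul, ← exp_nat_mul]; congr 1; push_cast; ring
  have h2 : (exp t ^ (2 + 2 * μ)) ^ (1 / (2 + 2 * μ)) = exp t := by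
    rw [← rpow_mul (exp_pos t).le, mul_one_div_cancel (by positivity), rpow_one]
  simp only [grho, grushinDilation, norm_smul, norm_eq_abs, abs_exp]
  rw [mul_rpow (exp_pos t).le (norm_nonneg _), mul_pow, ← h1]
  rw [mul_left_comm, ← mul_add, mul_rpow (by positivity) (by positivity), h2]

lemma continuous_grushinDilation (μ : ℝ) :
    Continuous fun q : ℝ × (EuclideanSpace ℝ (Fin d) × EuclideanSpace ℝ (Fin k)) =>
      grushinDilation μ q.1 q.2 := by
  unfold grushinDilation; fun_prop

lemma map_grushinDilation (μ t : ℝ) :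
    Measure.map (grushinDilation μ t)
      (volume : Measure (EuclideanSpace ℝ (Fin d) × EuclideanSpace ℝ (Fin k))) =
      ENNReal.ofReal (exp (-(d + (1 + μ) * k) * t)) • volume := by
  have h := Measure.map_prod_map (volume : Measure (EuclideanSpace ℝ (Fin d)))
    (volume : Measure (EuclideanSpace ℝ (Fin k)))
    (measurable_const_smul (exp t)) (measurable_const_smul (exp ((1 + μ) * t)))
  rw [Measure.map_addHaar_smul _ (exp_ne_zero _), Measure.map_addHaar_smul _ (exp_ne_zero _),
    Measure.prod_smul_left, Measure.prod_smul_right, smul_smul,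
    ← ENNReal.ofReal_mul (abs_nonneg _)] at h
  rw [Measure.volume_eq_prod]
  refine h.symm.trans ?_
  congr 2
  simp only [finrank_euclideanSpace, Fintype.card_fin, ← exp_nat_mul, ← exp_neg, abs_exp,
    ← exp_add]
  ring_nf

lemma lintegral_comp_grushinDilation (μ t : ℝ)
    {f : EuclideanSpace ℝ (Fin d) × EuclideanSpace ℝ (Fin k) → ℝ≥0∞} (hf : Measurable f) :
    ∫⁻ z, f (grushinDilation μ t z) =
      ENNReal.ofReal (exp (-(d + (1 + μ) * k) * t)) * ∫⁻ z, f z := by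
  have hm : Measurable (grushinDilation μ t :
      EuclideanSpace ℝ (Fin d) × EuclideanSpace ℝ (Fin k) → _) :=
    ((continuous_grushinDilation μ).comp (Continuous.prodMk_right t)).measurable
  rw [← lintegral_map hf hm, map_grushinDilation, lintegral_smul_measure, smul_eq_mul]

lemma hasDerivAt_comp_grushinDilation (μ t : ℝ)
    {u : EuclideanSpace ℝ (Fin d) × EuclideanSpace ℝ (Fin k) → ℝ} (hu : Differentiable ℝ u)
    (z : EuclideanSpace ℝ (Fin d) × EuclideanSpace ℝ (Fin k)) :
    HasDerivAt (fun t => u (grushinDilation μ t z))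
      (grushinEuler μ u (grushinDilation μ t z)) t := by
  have h1 : HasDerivAt (fun t => grushinDilation μ t z)
      (exp t • z.1, (exp ((1 + μ) * t) * (1 + μ)) • z.2) t := by
    refine HasDerivAt.prodMk ((hasDerivAt_exp t).smul_const z.1) (HasDerivAt.smul_const ?_ z.2)
    simpa using ((hasDerivAt_id t).const_mul (1 + μ)).exp
  refine ((hu _).hasFDerivAt.comp_hasDerivAt t h1).congr_deriv ?_
  simp [grushinEuler, grushinDilation, smul_smul, mul_comm]

lemma continuous_grushinEuler (μ : ℝ)
    {u : EuclideanSpace ℝ (Fin d) × EuclideanSpace ℝ (Fin k) → ℝ} (hu : ContDiff ℝ 1 u) :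
    Continuous (grushinEuler μ u) := by
  unfold grushinEuler
  exact (hu.continuous_fderiv one_ne_zero).clm_apply (by fun_prop)

lemma exp_mul_norm_le_norm_grushinDilation {μ t : ℝ} (hμ : 0 < μ) (ht : 0 ≤ t)
    (z : EuclideanSpace ℝ (Fin d) × EuclideanSpace ℝ (Fin k)) :
    exp t * ‖z‖ ≤ ‖grushinDilation μ t z‖ := by
  have h : exp t ≤ exp ((1 + μ) * t) := exp_le_exp.2 (by nlinarith [mul_nonneg hμ.le ht])
  rw [Prod.norm_def, Prod.norm_def, mul_max_of_nonneg _ _ (exp_pos t).le]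
  simp only [grushinDilation, norm_smul, norm_eq_abs, abs_exp]
  gcongr

lemma enorm_le_lintegral_grushinEuler {μ : ℝ} (hμ : 0 < μ)
    {u : EuclideanSpace ℝ (Fin d) × EuclideanSpace ℝ (Fin k) → ℝ} (hu : ContDiff ℝ 1 u)
    (hc : HasCompactSupport u)
    {z : EuclideanSpace ℝ (Fin d) × EuclideanSpace ℝ (Fin k)} (hz : z ≠ 0) :
    ‖u z‖ₑ ≤ ∫⁻ t in Ioi (0 : ℝ), ‖grushinEuler μ u (grushinDilation μ t z)‖ₑ := by
  obtain ⟨R, hR⟩ := hc.isCompact.isBounded.subset_closedBall 0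
  have hz' : 0 < ‖z‖ := norm_pos_iff.2 hz
  set T : ℝ := |R| / ‖z‖ with hT
  have hT0 : 0 ≤ T := by positivity
  have huT : u (grushinDilation μ T z) = 0 := by
    by_contra hne
    have h1 := hR (subset_tsupport u hne)
    rw [mem_closedBall_zero_iff] at h1
    have h2 := exp_mul_norm_le_norm_grushinDilation hμ hT0 z
    have h3 : T * ‖z‖ = |R| := div_mul_cancel₀ _ hz'.ne'
    nlinarith [add_one_le_exp T, le_abs_self R]
  have hcont : Continuous fun t => grushinEuler μ u (grushinDilation μ t z) :=
    (continuous_grushinEuler μ hu).comp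
      ((continuous_grushinDilation μ).comp (Continuous.prodMk_left z))
  have hftc := intervalIntegral.integral_eq_sub_of_hasDerivAt (a := 0) (b := T)
    (fun t _ => hasDerivAt_comp_grushinDilation μ t (hu.differentiable one_ne_zero) z)
    (hcont.intervalIntegrable _ _)
  have h0 : grushinDilation μ 0 z = z := by simp [grushinDilation]
  rw [huT, h0, zero_sub, intervalIntegral.integral_of_le hT0] at hftc
  rw [← enorm_neg, ← hftc]
  exact (enorm_integral_le_lintegral_enorm _).trans (lintegral_mono_set Ioc_subset_Ioi_self)

lemma lintegral_ofReal_exp_neg_mul_Ioi {c : ℝ} (hc : 0 < c) :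
    ∫⁻ t in Ioi (0 : ℝ), ENNReal.ofReal (exp (-c * t)) = ENNReal.ofReal c⁻¹ := by
  rw [← ofReal_integral_eq_lintegral_ofReal (exp_neg_integrableOn_Ioi 0 hc)
    (ae_of_all _ fun _ => (exp_pos _).le), integral_exp_mul_Ioi (neg_neg_iff_pos.2 hc)]
  simp

lemma lintegral_Ioi_rpow_le {p c : ℝ} (hp : 1 < p) (hc : 0 < c) {F : ℝ → ℝ≥0∞}
    (hF : Measurable F) :
    (∫⁻ t in Ioi (0 : ℝ), F t) ^ p ≤ ENNReal.ofReal (c⁻¹ ^ (p - 1)) *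
      ∫⁻ t in Ioi (0 : ℝ), ENNReal.ofReal (exp (c * (p - 1) * t)) * F t ^ p := by
  have hp0 : 0 < p := by linarith
  have hp1 : 0 < p - 1 := by linarith
  have hpq : p.HolderConjugate (p / (p - 1)) := Real.HolderConjugate.conjExponent hp
  have hexp : ∀ t, ENNReal.ofReal (exp (-c * t)) =
      ENNReal.ofReal (exp (-c * (p - 1) / p * t)) ^ (p / (p - 1)) := fun t => by
    rw [ENNReal.ofReal_rpow_of_pos (exp_pos _), ← exp_mul]
    congr 2; field_simp
  have hexp' : ∀ t, ENNReal.ofReal (exp (c * (p - 1) * t)) * F t ^ p =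
      (ENNReal.ofReal (exp (c * (p - 1) / p * t)) * F t) ^ p := fun t => by
    rw [ENNReal.mul_rpow_of_nonneg _ _ hp0.le, ENNReal.ofReal_rpow_of_pos (exp_pos _), ← exp_mul]
    congr 3; field_simp
  have hsplit : ∀ t, F t = (ENNReal.ofReal (exp (c * (p - 1) / p * t)) * F t) *
      ENNReal.ofReal (exp (-c * (p - 1) / p * t)) := fun t => by
    rw [mul_right_comm, ← ENNReal.ofReal_mul (exp_pos _).le, ← exp_add]
    ring_nf; simp
  have h := ENNReal.lintegral_mul_le_Lp_mul_Lq (volume.restrict (Ioi (0 : ℝ))) hpq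
    (f := fun t => ENNReal.ofReal (exp (c * (p - 1) / p * t)) * F t)
    (g := fun t => ENNReal.ofReal (exp (-c * (p - 1) / p * t)))
    (by fun_prop) (by fun_prop)
  simp only [Pi.mul_apply, ← hsplit, ← hexp, ← hexp'] at h
  rw [lintegral_ofReal_exp_neg_mul_Ioi hc] at h
  refine (ENNReal.rpow_le_rpow h hp0.le).trans_eq ?_
  rw [ENNReal.mul_rpow_of_nonneg _ _ hp0.le, ← ENNReal.rpow_mul, ← ENNReal.rpow_mul,
    one_div_mul_cancel hp0.ne', ENNReal.rpow_one, mul_comm,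
    ENNReal.ofReal_rpow_of_pos (inv_pos.2 hc)]
  congr 3
  field_simp

/-- Hardy's inequality along the orbits of the anisotropic dilations, for a weight that is
homogeneous of degree `s - Q`. -/
lemma lintegral_weight_mul_le_grushinEuler {μ : ℝ} (hμ : 0 < μ) {p s : ℝ} (hp : 1 < p) (hs : 0 < s)
    {W : EuclideanSpace ℝ (Fin d) × EuclideanSpace ℝ (Fin k) → ℝ≥0∞} (hW : Measurable W)
    (hW0 : W 0 = 0)
    (hWt : ∀ t z, W (grushinDilation μ t z) =
      ENNReal.ofReal (exp ((s - (d + (1 + μ) * k)) * t)) * W z)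
    {u : EuclideanSpace ℝ (Fin d) × EuclideanSpace ℝ (Fin k) → ℝ} (hu : ContDiff ℝ 1 u)
    (hc : HasCompactSupport u) :
    ∫⁻ z, W z * ‖u z‖ₑ ^ p ≤
      ENNReal.ofReal ((p / s) ^ p) * ∫⁻ z, W z * ‖grushinEuler μ u z‖ₑ ^ p := by
  have hp0 : 0 < p := by linarith
  set c := s / p with hcdef
  have hc0 : 0 < c := by positivity
  have hEm : Measurable fun z => ‖grushinEuler μ u z‖ₑ ^ p :=
    (continuous_grushinEuler μ hu).measurable.enorm.pow_const p
  have hjoint : Measurable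
      fun q : ℝ × (EuclideanSpace ℝ (Fin d) × EuclideanSpace ℝ (Fin k)) =>
        ‖grushinEuler μ u (grushinDilation μ q.1 q.2)‖ₑ :=
    ((continuous_grushinEuler μ hu).comp (continuous_grushinDilation μ)).measurable.enorm
  have hscale : ∀ t, ∫⁻ z, W z * ‖grushinEuler μ u (grushinDilation μ t z)‖ₑ ^ p =
      ENNReal.ofReal (exp (-s * t)) * ∫⁻ z, W z * ‖grushinEuler μ u z‖ₑ ^ p := fun t => by
    have h1 := lintegral_comp_grushinDilation μ t (hW.mul hEm)
    simp only [hWt, mul_assoc, Pi.mul_apply] at h1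
    rw [lintegral_const_mul' _ _ ENNReal.ofReal_ne_top] at h1
    have h2 := congrArg (ENNReal.ofReal (exp (-(s - (d + (1 + μ) * k)) * t)) * ·) h1
    simp only [← mul_assoc, ← ENNReal.ofReal_mul (exp_pos _).le, ← exp_add] at h2
    ring_nf at h2 ⊢
    simpa using h2
  have hpt : ∀ z, W z * ‖u z‖ₑ ^ p ≤ ENNReal.ofReal (c⁻¹ ^ (p - 1)) *
      ∫⁻ t in Ioi (0 : ℝ), W z * (ENNReal.ofReal (exp (c * (p - 1) * t)) *
        ‖grushinEuler μ u (grushinDilation μ t z)‖ₑ ^ p) := fun z => by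
    have hm : Measurable fun t => ‖grushinEuler μ u (grushinDilation μ t z)‖ₑ :=
      hjoint.comp measurable_prodMk_right
    rcases eq_or_ne z 0 with rfl | hz
    · simp [hW0]
    · rw [lintegral_const_mul _ (by fun_prop), mul_left_comm]
      gcongr
      exact (ENNReal.rpow_le_rpow (enorm_le_lintegral_grushinEuler hμ hu hc hz) hp0.le).trans
        (lintegral_Ioi_rpow_le hp hc0 hm)
  calc ∫⁻ z, W z * ‖u z‖ₑ ^ p
      ≤ ∫⁻ z, ENNReal.ofReal (c⁻¹ ^ (p - 1)) *
        ∫⁻ t in Ioi (0 : ℝ), W z * (ENNReal.ofReal (exp (c * (p - 1) * t)) *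
          ‖grushinEuler μ u (grushinDilation μ t z)‖ₑ ^ p) := lintegral_mono hpt
    _ = ENNReal.ofReal (c⁻¹ ^ (p - 1)) * ∫⁻ t in Ioi (0 : ℝ), ∫⁻ z,
          W z * (ENNReal.ofReal (exp (c * (p - 1) * t)) *
          ‖grushinEuler μ u (grushinDilation μ t z)‖ₑ ^ p) := by
        rw [lintegral_const_mul' _ _ ENNReal.ofReal_ne_top, lintegral_lintegral_swap]
        have := hjoint.comp measurable_swap
        simp only [Function.comp_def, Prod.fst_swap, Prod.snd_swap] at this
        refine Measurable.aemeasurable ?_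
        unfold Function.uncurry
        fun_prop
    _ = ENNReal.ofReal (c⁻¹ ^ (p - 1)) * ∫⁻ t in Ioi (0 : ℝ),
          ENNReal.ofReal (exp (-c * t)) * ∫⁻ z, W z * ‖grushinEuler μ u z‖ₑ ^ p := by
        congr 1
        refine lintegral_congr fun t => ?_
        simp only [mul_left_comm (W _)]
        rw [lintegral_const_mul' _ _ ENNReal.ofReal_ne_top, hscale, ← mul_assoc,
          ← ENNReal.ofReal_mul (exp_pos _).le, ← exp_add]
        congr 3
        rw [hcdef]
        field_simp
        ring
    _ = _ := by
        rw [lintegral_mul_const _ (by fun_prop), lintegral_ofReal_exp_neg_mul_Ioi hc0, ← mul_assoc,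
          ← ENNReal.ofReal_mul (by positivity)]
        congr 2
        rw [← inv_div, ← hcdef, ← rpow_add_one (by positivity)]
        ring_nf

lemma fderiv_comp_prodMk_left {u : EuclideanSpace ℝ (Fin d) × EuclideanSpace ℝ (Fin k) → ℝ}
    (hu : Differentiable ℝ u) (z : EuclideanSpace ℝ (Fin d) × EuclideanSpace ℝ (Fin k)) :
    fderiv ℝ (fun x => u (x, z.2)) z.1 = fderiv ℝ u z ∘L ContinuousLinearMap.inl ℝ _ _ :=
  ((hu z).hasFDerivAt.comp z.1 (hasFDerivAt_prodMk_left z.1 z.2)).fderiv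

lemma fderiv_comp_prodMk_right {u : EuclideanSpace ℝ (Fin d) × EuclideanSpace ℝ (Fin k) → ℝ}
    (hu : Differentiable ℝ u) (z : EuclideanSpace ℝ (Fin d) × EuclideanSpace ℝ (Fin k)) :
    fderiv ℝ (fun y => u (z.1, y)) z.2 = fderiv ℝ u z ∘L ContinuousLinearMap.inr ℝ _ _ :=
  ((hu z).hasFDerivAt.comp z.2 (hasFDerivAt_prodMk_right z.1 z.2)).fderiv

lemma gradMuNorm_eq (μ : ℝ) {u : EuclideanSpace ℝ (Fin d) × EuclideanSpace ℝ (Fin k) → ℝ}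
    (hu : Differentiable ℝ u) (z : EuclideanSpace ℝ (Fin d) × EuclideanSpace ℝ (Fin k)) :
    gradMuNorm μ u z = √(‖fderiv ℝ u z ∘L ContinuousLinearMap.inl ℝ _ _‖ ^ 2 +
      (‖z.1‖ ^ μ * ‖fderiv ℝ u z ∘L ContinuousLinearMap.inr ℝ _ _‖) ^ 2) := by
  simp only [gradMuNorm, pairNorm, gradMu, gradient, norm_smul, LinearIsometryEquiv.norm_map,
    fderiv_comp_prodMk_left hu, fderiv_comp_prodMk_right hu,
    norm_of_nonneg (rpow_nonneg (norm_nonneg z.1) μ)]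

lemma gradMuNorm_nonneg (μ : ℝ) (u : EuclideanSpace ℝ (Fin d) × EuclideanSpace ℝ (Fin k) → ℝ)
    (z : EuclideanSpace ℝ (Fin d) × EuclideanSpace ℝ (Fin k)) : 0 ≤ gradMuNorm μ u z :=
  sqrt_nonneg _

lemma continuous_gradMuNorm {μ : ℝ} (hμ : 0 < μ)
    {u : EuclideanSpace ℝ (Fin d) × EuclideanSpace ℝ (Fin k) → ℝ} (hu : ContDiff ℝ 1 u) :
    Continuous (gradMuNorm μ u) := by
  rw [funext (gradMuNorm_eq μ (hu.differentiable one_ne_zero))]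
  have h1 := hu.continuous_fderiv one_ne_zero
  have h2 : Continuous fun z : EuclideanSpace ℝ (Fin d) × EuclideanSpace ℝ (Fin k) =>
      ‖z.1‖ ^ μ := continuous_fst.norm.rpow_const fun _ => Or.inr hμ.le
  fun_prop

lemma support_gradMuNorm_subset (μ : ℝ)
    {u : EuclideanSpace ℝ (Fin d) × EuclideanSpace ℝ (Fin k) → ℝ} (hu : Differentiable ℝ u) :
    Function.support (gradMuNorm μ u) ⊆ tsupport u := fun z hz => by
  by_contra hne
  refine hz ?_
  have : fderiv ℝ u z = 0 := Function.notMem_support.1 fun h => hne (support_fderiv_subset ℝ h)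
  simp [gradMuNorm_eq μ hu, this]

lemma norm_rpow_mul_abs_grushinEuler_le {μ : ℝ} (hμ : 0 < μ)
    {u : EuclideanSpace ℝ (Fin d) × EuclideanSpace ℝ (Fin k) → ℝ} (hu : Differentiable ℝ u)
    (z : EuclideanSpace ℝ (Fin d) × EuclideanSpace ℝ (Fin k)) :
    ‖z.1‖ ^ μ * |grushinEuler μ u z| ≤ grho μ z ^ (1 + μ) * gradMuNorm μ u z := by
  set A := fderiv ℝ u z ∘L ContinuousLinearMap.inl ℝ _ _ with hA
  set B := fderiv ℝ u z ∘L ContinuousLinearMap.inr ℝ _ _ with hB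
  have hE : grushinEuler μ u z = A z.1 + (1 + μ) * B z.2 := by
    rw [grushinEuler, hA, hB, ← smul_eq_mul, ← map_smul]
    simp only [ContinuousLinearMap.comp_apply, ContinuousLinearMap.inl_apply,
      ContinuousLinearMap.inr_apply, ← map_add]
    simp
  have h1 : |grushinEuler μ u z| ≤ ‖A‖ * ‖z.1‖ + (1 + μ) * (‖B‖ * ‖z.2‖) := by
    rw [hE]
    refine (abs_add_le _ _).trans (add_le_add (A.le_opNorm _) ?_)
    rw [abs_mul, abs_of_pos (by positivity : 0 < 1 + μ)]
    exact mul_le_mul_of_nonneg_left (B.le_opNorm _) (by positivity)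
  have hx : ‖z.1‖ ^ (2 + 2 * μ) = (‖z.1‖ ^ μ * ‖z.1‖) ^ 2 := by
    rcases eq_or_ne z.1 0 with h | h
    · simp [h, zero_rpow (by positivity : 2 + 2 * μ ≠ 0)]
    · rw [← rpow_add_one (norm_ne_zero_iff.2 h), ← rpow_natCast, ← rpow_mul (norm_nonneg _)]
      push_cast; ring_nf
  rw [grho_rpow_one_add hμ, gradMuNorm_eq μ hu, ← sqrt_mul (by positivity), ← hA, ← hB, hx]
  refine le_sqrt_of_sq_le ?_
  have h2 : 0 ≤ ‖z.1‖ ^ μ := by positivity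
  calc (‖z.1‖ ^ μ * |grushinEuler μ u z|) ^ 2
      ≤ (‖z.1‖ ^ μ * (‖A‖ * ‖z.1‖ + (1 + μ) * (‖B‖ * ‖z.2‖))) ^ 2 := by gcongr
    _ ≤ _ := by
      nlinarith [sq_nonneg (‖z.1‖ ^ μ * ‖z.1‖ * (‖z.1‖ ^ μ * ‖B‖) - (1 + μ) * ‖z.2‖ * ‖A‖)]

/-- The weighted dilation derivative is dominated by the weighted Grushin gradient. -/
lemma weight_mul_grushinEuler_rpow_le {μ : ℝ} (hμ : 0 < μ) {p : ℝ} (hp : 0 < p) (a : ℝ)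
    {u : EuclideanSpace ℝ (Fin d) × EuclideanSpace ℝ (Fin k) → ℝ} (hu : Differentiable ℝ u)
    (z : EuclideanSpace ℝ (Fin d) × EuclideanSpace ℝ (Fin k)) :
    grho μ z ^ a * (‖z.1‖ ^ (μ * p) / grho μ z ^ (μ * p)) * (grho μ z ^ p)⁻¹ *
      |grushinEuler μ u z| ^ p ≤ grho μ z ^ a * gradMuNorm μ u z ^ p := by
  have hg := gradMuNorm_nonneg μ u z
  have ha : 0 ≤ grho μ z ^ a := rpow_nonneg (grho_nonneg μ z) a
  rcases (grho_nonneg μ z).eq_or_lt with h0 | h0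
  · rw [← h0] at ha ⊢
    rw [zero_rpow hp.ne']
    simp only [inv_zero, mul_zero, zero_mul]
    positivity
  · have h1 := rpow_le_rpow (by positivity) (norm_rpow_mul_abs_grushinEuler_le hμ hu z) hp.le
    rw [mul_rpow (by positivity) (by positivity), mul_rpow (by positivity) hg,
      ← rpow_mul (norm_nonneg _), ← rpow_mul h0.le, one_add_mul, rpow_add h0] at h1
    rw [mul_assoc, mul_assoc]
    refine mul_le_mul_of_nonneg_left ?_ ha
    rw [← mul_assoc, ← div_eq_mul_inv, div_div, div_mul_eq_mul_div, div_le_iff₀ (by positivity)]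
    linarith

lemma integrableOn_norm_rpow_ball {E : Type*} [NormedAddCommGroup E] [NormedSpace ℝ E]
    [Nontrivial E] [FiniteDimensional ℝ E] [MeasurableSpace E] [BorelSpace E] (ν : Measure E)
    [ν.IsAddHaarMeasure] {a R : ℝ} (ha : -Module.finrank ℝ E < a) (hR : 0 < R) :
    IntegrableOn (fun x : E => ‖x‖ ^ a) (Metric.ball 0 R) ν := by
  rw [integrableOn_fun_norm_addHaar ν (f := fun r => r ^ a)]
  have h1 : IntegrableOn (fun r : ℝ => r ^ (((Module.finrank ℝ E - 1 : ℕ) : ℝ) + a)) (Ioo 0 R) := by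
    rw [intervalIntegral.integrableOn_Ioo_rpow_iff hR, Nat.cast_sub Module.finrank_pos]
    push_cast
    linarith
  refine h1.congr_fun (fun r hr => ?_) measurableSet_Ioo
  simp only [rpow_add hr.1, rpow_natCast, smul_eq_mul]

lemma integrableOn_grho_rpow_ball {μ : ℝ} (hμ : 0 < μ) (hd : 1 ≤ d) (hk : 1 ≤ k) {a R : ℝ}
    (ha : -(d + (1 + μ) * k) < a) (hR : 0 < R) :
    IntegrableOn
      (fun z : EuclideanSpace ℝ (Fin d) × EuclideanSpace ℝ (Fin k) => grho μ z ^ a)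
      (Metric.ball 0 R) := by
  have : NeZero d := ⟨by omega⟩
  have : NeZero k := ⟨by omega⟩
  have hd' : (0 : ℝ) < d := by exact_mod_cast hd
  have hk' : (0 : ℝ) < k := by exact_mod_cast hk
  rcases le_or_gt 0 a with ha0 | ha0
  · have hcont : Continuous
        fun z : EuclideanSpace ℝ (Fin d) × EuclideanSpace ℝ (Fin k) => grho μ z ^ a :=
      (continuous_grho hμ).rpow_const fun _ => Or.inr ha0
    exact (hcont.continuousOn.integrableOn_compact (isCompact_closedBall 0 R)).mono_set
      Metric.ball_subset_closedBall
  set θ : ℝ := a / (d + (1 + μ) * k) with hθ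
  have hQ : (0 : ℝ) < d + (1 + μ) * k := by positivity
  have hθ0 : θ < 0 := div_neg_of_neg_of_pos ha0 hQ
  have hθ1 : -1 < θ := by rw [hθ, lt_div_iff₀ hQ]; linarith
  have haθ : a = θ * d + (1 + μ) * (θ * k) := by
    have : θ * (d + (1 + μ) * k) = a := div_mul_cancel₀ _ hQ.ne'
    linarith
  have hx : IntegrableOn (fun x : EuclideanSpace ℝ (Fin d) => ‖x‖ ^ (θ * d)) (Metric.ball 0 R) :=
    integrableOn_norm_rpow_ball _
      (by simp only [finrank_euclideanSpace, Fintype.card_fin]; nlinarith) hR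
  have hy : IntegrableOn (fun x : EuclideanSpace ℝ (Fin k) => ‖x‖ ^ (θ * k)) (Metric.ball 0 R) :=
    integrableOn_norm_rpow_ball _
      (by simp only [finrank_euclideanSpace, Fintype.card_fin]; nlinarith) hR
  have hxy := Integrable.mul_prod hx hy
  rw [Measure.prod_restrict, ball_prod_same, ← Measure.volume_eq_prod] at hxy
  refine Integrable.mono' hxy
    ((continuous_grho hμ).measurable.pow_const a).aestronglyMeasurable (ae_restrict_of_ae ?_)
  have h1 : ∀ᵐ z : EuclideanSpace ℝ (Fin d) × EuclideanSpace ℝ (Fin k), z.1 ≠ 0 :=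
    Measure.quasiMeasurePreserving_fst.ae (Measure.ae_ne volume 0)
  have h2 : ∀ᵐ z : EuclideanSpace ℝ (Fin d) × EuclideanSpace ℝ (Fin k), z.2 ≠ 0 :=
    Measure.quasiMeasurePreserving_snd.ae (Measure.ae_ne volume 0)
  filter_upwards [h1, h2] with z hz1 hz2
  have hz1' := norm_pos_iff.2 hz1
  have hz2' := norm_pos_iff.2 hz2
  have hρ : 0 < grho μ z := hz1'.trans_le (norm_fst_le_grho hμ z)
  rw [norm_of_nonneg (by positivity), haθ, rpow_add hρ, rpow_mul hρ.le (1 + μ)]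
  gcongr ?_ * ?_
  · exact rpow_le_rpow_of_nonpos hz1' (norm_fst_le_grho hμ z) (by nlinarith)
  · exact rpow_le_rpow_of_nonpos hz2' (norm_snd_le_grho_rpow hμ z) (by nlinarith)

lemma integrable_grho_rpow_mul_gradMuNorm_rpow {μ : ℝ} (hμ : 0 < μ) (hd : 1 ≤ d) (hk : 1 ≤ k)
    {a p : ℝ} (ha : -(d + (1 + μ) * k) < a) (hp : 0 < p)
    {u : EuclideanSpace ℝ (Fin d) × EuclideanSpace ℝ (Fin k) → ℝ} (hu : ContDiff ℝ 1 u)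
    (hc : HasCompactSupport u) :
    Integrable fun z => grho μ z ^ a * gradMuNorm μ u z ^ p := by
  have hsub := support_gradMuNorm_subset μ (hu.differentiable one_ne_zero)
  obtain ⟨R, hR0, hR⟩ := hc.isCompact.isBounded.subset_ball_lt 0 0
  have hcont : Continuous fun z => gradMuNorm μ u z ^ p :=
    (continuous_gradMuNorm hμ hu).rpow_const fun _ => Or.inr hp.le
  have hcs : HasCompactSupport fun z => gradMuNorm μ u z ^ p :=
    HasCompactSupport.intro hc.isCompact fun z hz => by
      rw [Function.notMem_support.1 fun h => hz (hsub h), zero_rpow hp.ne']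
  obtain ⟨C, hC⟩ := hcs.exists_bound_of_continuous hcont
  rw [← integrableOn_iff_integrable_of_support_subset (s := Metric.ball 0 R)]
  · exact (integrableOn_grho_rpow_ball hμ hd hk ha hR0).mul_bdd
      hcont.aestronglyMeasurable (ae_of_all _ hC)
  · intro z hz
    refine hR (hsub fun h => hz ?_)
    simp [h, zero_rpow hp.ne']

/-- Weighted Hardy type inequality for Grushin operators with explicit constant. -/
theorem weighted_hardy_grushin_explicit_constant
    (d k : ℕ) (hd : 1 ≤ d) (hk : 1 ≤ k) (μ : ℝ) (hμ : 0 < μ)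
    (Q : ℝ) (hQ : Q = d + (1 + μ) * k)
    (p α : ℝ) (hp1 : 1 < p) (hpα : 0 < 1 / p + α / Q) (hQpα : 0 < Q - p + α * p) :
    ∀ u : EuclideanSpace ℝ (Fin d) × EuclideanSpace ℝ (Fin k) → ℝ,
      ContDiff ℝ (⊤ : ℕ∞) u → HasCompactSupport u →
      ∫ z, grho μ z ^ (α * p) * (‖z.1‖ ^ (μ * p) / grho μ z ^ (μ * p)) * (|u z| ^ p / grho μ z ^ p)
        ≤ (p / (Q - p + α * p)) ^ p * ∫ z, grho μ z ^ (α * p) * gradMuNorm μ u z ^ p := by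
  intro u hu hc
  have hu1 : ContDiff ℝ 1 u := hu.of_le (by exact_mod_cast le_top)
  have hp0 : 0 < p := by linarith
  have hgrad : Integrable fun z => grho μ z ^ (α * p) * gradMuNorm μ u z ^ p :=
    integrable_grho_rpow_mul_gradMuNorm_rpow hμ hd hk (by linarith) hp0 hu1 hc
  set w : EuclideanSpace ℝ (Fin d) × EuclideanSpace ℝ (Fin k) → ℝ := fun z =>
    grho μ z ^ (α * p) * (‖z.1‖ ^ (μ * p) / grho μ z ^ (μ * p)) * (grho μ z ^ p)⁻¹ with hw
  have hw0 : ∀ z, 0 ≤ w z := fun z => by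
    have := grho_nonneg μ z
    positivity
  have hρm : Measurable (grho μ : EuclideanSpace ℝ (Fin d) × EuclideanSpace ℝ (Fin k) → ℝ) :=
    (continuous_grho hμ).measurable
  have hwm : Measurable w := by fun_prop
  have hwt : ∀ t z, w (grushinDilation μ t z) =
      exp (((Q - p + α * p) - (d + (1 + μ) * k)) * t) * w z := fun t z => by
    have hρ := grho_nonneg μ z
    have hexp : exp (((Q - p + α * p) - (d + (1 + μ) * k)) * t) =
        exp t ^ (α * p) * (exp t ^ p)⁻¹ := by
      rw [← exp_mul, ← exp_mul, ← exp_neg, ← exp_add, hQ]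
      ring_nf
    have hne := (rpow_pos_of_pos (exp_pos t) (μ * p)).ne'
    simp only [hw, grho_grushinDilation hμ]
    simp only [grushinDilation, norm_smul, norm_eq_abs, abs_exp]
    rw [mul_rpow (exp_pos t).le hρ, mul_rpow (exp_pos t).le hρ, mul_rpow (exp_pos t).le hρ,
      mul_rpow (exp_pos t).le (norm_nonneg _), mul_div_mul_left _ _ hne, mul_inv, hexp]
    ring
  have hardy := lintegral_weight_mul_le_grushinEuler (W := fun z => ENNReal.ofReal (w z)) hμ hp1
    hQpα (by fun_prop)
    (by simp [hw, zero_rpow (mul_pos hμ hp0).ne'])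
    (fun t z => by rw [hwt, ENNReal.ofReal_mul (exp_pos _).le]) hu1 hc
  have hkey : ∫⁻ z, ENNReal.ofReal (w z * |u z| ^ p) ≤
      ENNReal.ofReal ((p / (Q - p + α * p)) ^ p *
        ∫ z, grho μ z ^ (α * p) * gradMuNorm μ u z ^ p) := by
    have hofReal : ∀ (v : EuclideanSpace ℝ (Fin d) × EuclideanSpace ℝ (Fin k) → ℝ) z,
        ENNReal.ofReal (w z) * ‖v z‖ₑ ^ p = ENNReal.ofReal (w z * |v z| ^ p) := fun v z => by
      rw [ENNReal.ofReal_mul (hw0 z), enorm_eq_ofReal_abs,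
        ENNReal.ofReal_rpow_of_nonneg (abs_nonneg _) hp0.le]
    simp only [hofReal] at hardy
    refine hardy.trans ?_
    rw [ENNReal.ofReal_mul (by positivity), ofReal_integral_eq_lintegral_ofReal hgrad
      (ae_of_all _ fun z => mul_nonneg (rpow_nonneg (grho_nonneg μ z) _)
        (rpow_nonneg (gradMuNorm_nonneg μ u z) _))]
    exact mul_le_mul' le_rfl (lintegral_mono fun z => ENNReal.ofReal_le_ofReal
      (weight_mul_grushinEuler_rpow_le hμ hp0 _ (hu1.differentiable one_ne_zero) z))
  have hlhs : ∀ z, grho μ z ^ (α * p) * (‖z.1‖ ^ (μ * p) / grho μ z ^ (μ * p)) *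
      (|u z| ^ p / grho μ z ^ p) = w z * |u z| ^ p := fun z => by
    simp only [hw]; ring
  simp only [hlhs]
  have hum : Measurable u := hu1.continuous.measurable
  rw [integral_eq_lintegral_of_nonneg_ae
    (ae_of_all _ fun z => mul_nonneg (hw0 z) (rpow_nonneg (abs_nonneg _) _))
    (Measurable.aestronglyMeasurable (by fun_prop))]
  refine ENNReal.toReal_le_of_le_ofReal ?_ hkey
  exact mul_nonneg (by positivity) (integral_nonneg fun z =>
    mul_nonneg (rpow_nonneg (grho_nonneg μ z) _) (rpow_nonneg (gradMuNorm_nonneg μ u z) _))
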